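/- arXiv:1910.08396 — 2 statements merged into one kernel-verified Lean document; each statement's English description precedes it below -/
import Mathlib

section
/- Let A, B, C, D be four distinct concyclic points in the Euclidean plane ℝ² forming a convex cyclic quadrilateral in this order. Let p₁, p₂ be the semiperimeters of triangles ABC and ACD, and set r₁ = p₁ − dist A C and r₂ = p₂ − dist A C (the tangent lengths from B in ABC and from D in ACD). Then area(ABC) · area(ACD) = p₁ · p₂ · r₁ · r₂. -/
open Real EuclideanGeometry Metric MeasureTheory

lemma volume_standardTriangle_prod :
    volume {p : ℝ × ℝ | 0 ≤ p.1 ∧ 0 ≤ p.2 ∧ p.1 + p.2 ≤ 1} = ENNReal.ofReal (1 / 2) := by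
  have hm : MeasurableSet {p : ℝ × ℝ | 0 ≤ p.1 ∧ 0 ≤ p.2 ∧ p.1 + p.2 ≤ 1} := by
    measurability
  rw [Measure.volume_eq_prod, Measure.prod_apply hm]
  have hslice : ∀ x : ℝ,
      volume (Prod.mk x ⁻¹' {p : ℝ × ℝ | 0 ≤ p.1 ∧ 0 ≤ p.2 ∧ p.1 + p.2 ≤ 1})
        = (Set.Icc (0 : ℝ) 1).indicator (fun x => ENNReal.ofReal (1 - x)) x := by
    intro x
    by_cases hx : x ∈ Set.Icc (0 : ℝ) 1
    · have : Prod.mk x ⁻¹' {p : ℝ × ℝ | 0 ≤ p.1 ∧ 0 ≤ p.2 ∧ p.1 + p.2 ≤ 1}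
          = Set.Icc 0 (1 - x) := by
        ext y
        simp only [Set.mem_preimage, Set.mem_ofPred_eq, Set.mem_Icc] at hx ⊢
        constructor <;> intro h <;> grind
      rw [Set.indicator_of_mem hx, this, Real.volume_Icc, sub_zero]
    · have : Prod.mk x ⁻¹' {p : ℝ × ℝ | 0 ≤ p.1 ∧ 0 ≤ p.2 ∧ p.1 + p.2 ≤ 1} = ∅ := by
        ext y
        simp only [Set.mem_preimage, Set.mem_ofPred_eq, Set.mem_empty_iff_false, iff_false,
          Set.mem_Icc] at hx ⊢
        grind
      rw [Set.indicator_of_notMem hx, this, measure_empty]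
  simp_rw [hslice]
  rw [lintegral_indicator measurableSet_Icc, ← ofReal_integral_eq_lintegral_ofReal]
  · rw [integral_Icc_eq_integral_Ioc, ← intervalIntegral.integral_of_le zero_le_one,
      intervalIntegral.integral_sub (by simp) (by simp), integral_id]
    norm_num
  · exact (by fun_prop : Continuous fun x : ℝ => 1 - x).integrableOn_Icc
  · exact (ae_restrict_iff' measurableSet_Icc).2 (.of_forall fun x hx => sub_nonneg.2 hx.2)

lemma volume_standardTriangle :
    volume {p : EuclideanSpace ℝ (Fin 2) | 0 ≤ p 0 ∧ 0 ≤ p 1 ∧ p 0 + p 1 ≤ 1}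
      = ENNReal.ofReal (1 / 2) := by
  rw [← volume_standardTriangle_prod,
    ← ((volume_preserving_finTwoArrow ℝ).comp
      (PiLp.volume_preserving_ofLp (Fin 2))).measure_preimage
      (MeasurableSet.nullMeasurableSet (by measurability))]
  rfl

open scoped Pointwise in
lemma convexHull_triple_eq_image_standardTriangle (A B C : EuclideanSpace ℝ (Fin 2)) :
    convexHull ℝ {A, B, C} = A +ᵥ (Matrix.toLpLin 2 2
      (!![B 0 - A 0, C 0 - A 0; B 1 - A 1, C 1 - A 1] : Matrix (Fin 2) (Fin 2) ℝ) ''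
        {p : EuclideanSpace ℝ (Fin 2) | 0 ≤ p 0 ∧ 0 ≤ p 1 ∧ p 0 + p 1 ≤ 1}) := by
  ext x
  simp only [Set.mem_vadd_set, Set.mem_image, vadd_eq_add, exists_exists_and_eq_and]
  constructor
  · rw [convexHull_insert (Set.insert_nonempty _ _), convexHull_pair, convexJoin_singleton_left,
      Set.mem_iUnion₂]
    rintro ⟨z, ⟨c, d, hc, hd, hcd, rfl⟩, a, b, ha, hb, hab, rfl⟩
    refine ⟨!₂[b * c, b * d], ⟨by simpa using by positivity, by simpa using by positivity, ?_⟩, ?_⟩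
    · simp only [Matrix.cons_val_zero, Matrix.cons_val_one]
      rw [← mul_add, hcd]
      linarith
    · obtain rfl : a = 1 - b := by linarith
      obtain rfl : c = 1 - d := by linarith
      ext i
      fin_cases i <;> simp [Matrix.toLpLin_apply] <;> ring
  · rintro ⟨p, ⟨h0, h1, h2⟩, rfl⟩
    have hmem : ∑ i, ![1 - p 0 - p 1, p 0, p 1] i • ![A, B, C] i
        ∈ convexHull ℝ ({A, B, C} : Set (EuclideanSpace ℝ (Fin 2))) := by
      refine (convex_convexHull ℝ _).sum_mem ?_ ?_ ?_
      · intro i _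
        fin_cases i <;> simp [h0, h1]
        linarith
      · simp only [Fin.sum_univ_three, Matrix.cons_val]
        ring
      · intro i _
        apply subset_convexHull
        fin_cases i <;> simp
    convert hmem using 1
    ext i
    fin_cases i <;>
      simp [Matrix.toLpLin_apply, dotProduct, Fin.sum_univ_two, Fin.sum_univ_three] <;> ring

/-- The shoelace formula for the area of a triangle. -/
lemma volume_convexHull_triple (A B C : EuclideanSpace ℝ (Fin 2)) :
    (volume (convexHull ℝ {A, B, C})).toReal
      = |(B 0 - A 0) * (C 1 - A 1) - (B 1 - A 1) * (C 0 - A 0)| / 2 := by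
  rw [convexHull_triple_eq_image_standardTriangle, measure_vadd, Measure.addHaar_image_linearMap,
    volume_standardTriangle, LinearMap.det_toLpLin, Matrix.det_fin_two_of, ENNReal.toReal_mul,
    ENNReal.toReal_ofReal (abs_nonneg _), ENNReal.toReal_ofReal (by norm_num)]
  rw [mul_comm (C 0 - A 0)]
  ring

lemma dist_sq_eq_coord (A B : EuclideanSpace ℝ (Fin 2)) :
    dist A B ^ 2 = (A 0 - B 0) ^ 2 + (A 1 - B 1) ^ 2 := by
  rw [EuclideanSpace.dist_sq_eq, Fin.sum_univ_two, Real.dist_eq, Real.dist_eq, sq_abs, sq_abs]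

/-- The line through `A` and `C` separates `B` from `D` only if the signed areas of the triangles
they span with `A` and `C` have opposite signs. -/
lemma cross_mul_cross_neg_of_sOppSide {A B C D : EuclideanSpace ℝ (Fin 2)} (hAC : A ≠ C)
    (h : (affineSpan ℝ ({A, C} : Set (EuclideanSpace ℝ (Fin 2)))).SOppSide B D) :
    ((A 0 - B 0) * (C 1 - B 1) - (A 1 - B 1) * (C 0 - B 0)) *
      ((A 0 - D 0) * (C 1 - D 1) - (A 1 - D 1) * (C 0 - D 0)) < 0 := by
  rw [AffineSubspace.sOppSide_iff_exists_left (left_mem_affineSpan_pair ℝ A C)] at h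
  obtain ⟨hB, hD, p, hp, hray⟩ := h
  have hBA : B -ᵥ A ≠ 0 := by
    rw [vsub_ne_zero]
    rintro rfl
    exact hB (left_mem_affineSpan_pair ℝ _ _)
  have hpD : p -ᵥ D ≠ 0 := by
    rw [vsub_ne_zero]
    rintro rfl
    exact hD hp
  obtain ⟨r, hr, hrp⟩ := hray.exists_pos_left hBA hpD
  obtain ⟨t, rfl⟩ := mem_affineSpan_pair_iff_exists_lineMap_eq.1 hp
  have h0 := congrArg (fun v : EuclideanSpace ℝ (Fin 2) => v 0) hrp
  have h1 := congrArg (fun v : EuclideanSpace ℝ (Fin 2) => v 1) hrp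
  simp [AffineMap.lineMap_apply] at h0 h1
  have hQ : (A 0 - B 0) * (C 1 - B 1) - (A 1 - B 1) * (C 0 - B 0) ≠ 0 := by
    intro hQ
    have hpos : 0 < (A 0 - C 0) ^ 2 + (A 1 - C 1) ^ 2 := by
      rw [← dist_sq_eq_coord]
      have := dist_pos.2 hAC
      positivity
    apply hB
    rw [mem_affineSpan_pair_iff_exists_lineMap_eq]
    refine ⟨((B 0 - A 0) * (C 0 - A 0) + (B 1 - A 1) * (C 1 - A 1)) /
      ((A 0 - C 0) ^ 2 + (A 1 - C 1) ^ 2), ?_⟩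
    ext i
    fin_cases i <;> simp [AffineMap.lineMap_apply] <;> field_simp
    · linear_combination (C 1 - A 1) * hQ
    · linear_combination -(C 0 - A 0) * hQ
  have hQ' : (A 0 - D 0) * (C 1 - D 1) - (A 1 - D 1) * (C 0 - D 0)
      = -r * ((A 0 - B 0) * (C 1 - B 1) - (A 1 - B 1) * (C 0 - B 0)) := by
    linear_combination (A 1 - C 1) * h0 - (A 0 - C 0) * h1
  rw [hQ']
  have := mul_pos hr (sq_pos_of_ne_zero hQ)
  linarith

/-- Equality of the directed angles `ABC` and `ADC` modulo `π` for four concyclic points, in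
coordinates. -/
lemma dot_mul_cross_eq_of_concyclic (a1 a2 b1 b2 c1 c2 d1 d2 o1 o2 r : ℝ)
    (hA : (a1 - o1) ^ 2 + (a2 - o2) ^ 2 = r) (hB : (b1 - o1) ^ 2 + (b2 - o2) ^ 2 = r)
    (hC : (c1 - o1) ^ 2 + (c2 - o2) ^ 2 = r) (hD : (d1 - o1) ^ 2 + (d2 - o2) ^ 2 = r) :
    ((a1 - b1) * (c1 - b1) + (a2 - b2) * (c2 - b2))
        * ((a1 - d1) * (c2 - d2) - (a2 - d2) * (c1 - d1))
      = ((a1 - d1) * (c1 - d1) + (a2 - d2) * (c2 - d2))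
        * ((a1 - b1) * (c2 - b2) - (a2 - b2) * (c1 - b1)) := by
  linear_combination
    -((c1 - b1) * (d2 - b2) - (c2 - b2) * (d1 - b1)) * hA
    + ((c1 - a1) * (d2 - a2) - (c2 - a2) * (d1 - a1)) * hB
    - ((b1 - a1) * (d2 - a2) - (b2 - a2) * (d1 - a1)) * hC
    + ((b1 - a1) * (c2 - a2) - (b2 - a2) * (c1 - a1)) * hD

/-- The identity between areas and side lengths, in terms of the dot products `P`, `P'` and cross
products `Q`, `Q'` of the sides meeting at two opposite vertices. -/
lemma cross_mul_cross_eq_of_dot_mul_cross_eq {a b x d e P Q P' Q' : ℝ}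
    (ha : 0 < a) (hb : 0 < b) (hd : 0 < d) (he : 0 < e)
    (h1 : P ^ 2 + Q ^ 2 = (a * b) ^ 2) (h2 : P' ^ 2 + Q' ^ 2 = (d * e) ^ 2)
    (hx : x ^ 2 = a ^ 2 + b ^ 2 - 2 * P) (hx' : x ^ 2 = d ^ 2 + e ^ 2 - 2 * P')
    (hPQ : P * Q' = P' * Q) (hneg : Q * Q' < 0) :
    (|Q| / 2) * (|Q'| / 2)
      = ((a + b + x) / 2) * ((x + d + e) / 2) * ((a + b + x) / 2 - x) * ((x + d + e) / 2 - x) := by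
  have hQ' : Q' ≠ 0 := by rintro rfl; simp at hneg
  obtain ⟨t, ht, hQ⟩ : ∃ t : ℝ, 0 < t ∧ Q = -t * Q' :=
    ⟨-(Q * Q') / Q' ^ 2, div_pos (by linarith) (by positivity), by field_simp⟩
  have hP : P = -t * P' := by
    apply mul_right_cancel₀ hQ'
    rw [hPQ, hQ]; ring
  have hab : a * b = t * (d * e) := by
    apply (sq_eq_sq₀ (by positivity) (by positivity)).1
    rw [← h1, mul_pow, ← h2, hP, hQ]; ring
  have habx : ((a + b + x) / 2) * ((a + b + x) / 2 - x) = t * (d * e - P') / 2 := by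
    linear_combination hab / 2 - hx / 4 + hP / 2
  have hdex : ((x + d + e) / 2) * ((x + d + e) / 2 - x) = (d * e + P') / 2 := by
    linear_combination - hx' / 4
  have hcross : |Q| * |Q'| = t * Q' ^ 2 := by
    rw [← abs_mul, abs_of_neg hneg, hQ]; ring
  calc _ = |Q| * |Q'| / 4 := by ring
    _ = (t * (d * e - P') / 2) * ((d * e + P') / 2) := by rw [hcross]; linear_combination t / 4 * h2
    _ = _ := by rw [← habx, ← hdex]; ring

/-- In a convex cyclic quadrilateral `ABCD`, the product of the areas of the
triangles `ABC` and `ACD` equals `p₁·p₂·r₁·r₂`, where `p₁, p₂` are the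
semiperimeters and `r₁, r₂` the tangent lengths from `B` and `D`. -/
theorem area_product_cyclic_quadrilateral_semiperimeter
    (A B C D : EuclideanSpace ℝ (Fin 2))
    (hdist : A ≠ B ∧ A ≠ C ∧ A ≠ D ∧ B ≠ C ∧ B ≠ D ∧ C ≠ D)
    (hcyclic : EuclideanGeometry.Cospherical ({A, B, C, D} : Set (EuclideanSpace ℝ (Fin 2))))
    (hBD : (affineSpan ℝ ({A, C} : Set (EuclideanSpace ℝ (Fin 2)))).SOppSide B D)
    (hAC : (affineSpan ℝ ({B, D} : Set (EuclideanSpace ℝ (Fin 2)))).SOppSide A C) :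
    (volume (convexHull ℝ ({A, B, C} : Set (EuclideanSpace ℝ (Fin 2))))).toReal
      * (volume (convexHull ℝ ({A, C, D} : Set (EuclideanSpace ℝ (Fin 2))))).toReal
      = ((dist A B + dist B C + dist C A) / 2)
        * ((dist A C + dist C D + dist D A) / 2)
        * ((dist A B + dist B C + dist C A) / 2 - dist A C)
        * ((dist A C + dist C D + dist D A) / 2 - dist A C) := by
  obtain ⟨hAB, hAC', hAD, hBC, -, hCD⟩ := hdist
  obtain ⟨O, R, hO⟩ := hcyclic
  have hcirc : ∀ X ∈ ({A, B, C, D} : Set (EuclideanSpace ℝ (Fin 2))),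
      (X 0 - O 0) ^ 2 + (X 1 - O 1) ^ 2 = R ^ 2 := fun X hX => by
    rw [← dist_sq_eq_coord, hO X hX]
  have hang := dot_mul_cross_eq_of_concyclic (A 0) (A 1) (B 0) (B 1) (C 0) (C 1) (D 0) (D 1)
    (O 0) (O 1) (R ^ 2) (hcirc A (by simp)) (hcirc B (by simp)) (hcirc C (by simp))
    (hcirc D (by simp))
  have hmain := cross_mul_cross_eq_of_dot_mul_cross_eq (x := dist A C) (dist_pos.2 hAB)
    (dist_pos.2 hBC) (dist_pos.2 hCD) (dist_pos.2 hAD.symm)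
    (by simp only [mul_pow, dist_sq_eq_coord]; ring)
    (by simp only [mul_pow, dist_sq_eq_coord]; ring)
    (by simp only [dist_sq_eq_coord]; ring) (by simp only [dist_sq_eq_coord]; ring)
    hang (cross_mul_cross_neg_of_sOppSide hAC' hBD)
  rw [volume_convexHull_triple, volume_convexHull_triple, dist_comm C A]
  convert hmain using 3
  · rw [← abs_neg]
    ring_nf
  · ring_nf
end

section
/- Let n ≥ 1 and let Q₀, Q₁, …, Q_{n+1} be n+2 distinct points in the Euclidean plane ℝ² lying in this cyclic order on a common circle and in convex position. For j = 1, …, n let T_j be the triangle Q₀ Q_j Q_{j+1}, with semiperimeter p_j and inradius R_j, and set s_j = p_j − dist(Q_j, Q_{j+1}), r_j = p_j − dist(Q₀, Q_{j+1}), t_j = p_j − dist(Q₀, Q_j). Then for all 1 ≤ h < k ≤ n: R_h · R_k = r_h · t_k · ∏_{i=h+1}^{k−1} (p_i / s_i), where the empty product (when k = h+1) is 1. -/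
open Real EuclideanGeometry Metric MeasureTheory

/-- Twice the signed area of the triangle `A B C`. -/
def planeCross (A B C : EuclideanSpace ℝ (Fin 2)) : ℝ :=
  (B 0 - A 0) * (C 1 - A 1) - (B 1 - A 1) * (C 0 - A 0)

lemma dist_sq_eq_coords (A B : EuclideanSpace ℝ (Fin 2)) :
    dist A B ^ 2 = (B 0 - A 0) ^ 2 + (B 1 - A 1) ^ 2 := by
  rw [EuclideanSpace.dist_eq, Real.sq_sqrt (by positivity), Fin.sum_univ_two,
    Real.dist_eq, Real.dist_eq, sq_abs, sq_abs]
  ring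

/-- Base times height equals twice the area. -/
lemma infDist_line_mul_dist {A B : EuclideanSpace ℝ (Fin 2)} (hAB : A ≠ B)
    (P : EuclideanSpace ℝ (Fin 2)) :
    infDist P (affineSpan ℝ ({A, B} : Set (EuclideanSpace ℝ (Fin 2))) :
      Set (EuclideanSpace ℝ (Fin 2))) * dist A B = |planeCross A B P| := by
  have hd : 0 < dist A B := dist_pos.2 hAB
  have hd2 := dist_sq_eq_coords A B
  have key (c : ℝ) : (dist P (AffineMap.lineMap A B c) * dist A B) ^ 2 =
      planeCross A B P ^ 2 + (c * dist A B ^ 2 -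
        ((P 0 - A 0) * (B 0 - A 0) + (P 1 - A 1) * (B 1 - A 1))) ^ 2 := by
    rw [mul_pow, dist_sq_eq_coords P, hd2]
    simp only [AffineMap.lineMap_apply, vsub_eq_sub, vadd_eq_add, PiLp.add_apply,
      PiLp.smul_apply, PiLp.sub_apply, smul_eq_mul, planeCross]
    ring
  apply le_antisymm
  · set c := ((P 0 - A 0) * (B 0 - A 0) + (P 1 - A 1) * (B 1 - A 1)) / dist A B ^ 2 with hc
    have hmem := AffineMap.lineMap_mem_affineSpan_pair c A B
    refine (mul_le_mul_of_nonneg_right (infDist_le_dist_of_mem hmem) hd.le).trans ?_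
    refine (sq_le_sq₀ (by positivity) (abs_nonneg _)).1 ?_
    rw [key, sq_abs, hc, div_mul_cancel₀ _ (by positivity)]
    simp
  · rw [← div_le_iff₀ hd, le_infDist ⟨A, left_mem_affineSpan_pair ℝ A B⟩]
    intro y hy
    obtain ⟨c, rfl⟩ := mem_affineSpan_pair_iff_exists_lineMap_eq.1 hy
    rw [div_le_iff₀ hd]
    refine (sq_le_sq₀ (abs_nonneg _) (by positivity)).1 ?_
    rw [key, sq_abs]
    nlinarith [sq_nonneg (c * dist A B ^ 2 -
        ((P 0 - A 0) * (B 0 - A 0) + (P 1 - A 1) * (B 1 - A 1)))]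

/-- A point of a triangle at equal distances `R` from the three side lines satisfies
`R · perimeter = 2 · area`. -/
lemma inradius_mul_perimeter {A B C I : EuclideanSpace ℝ (Fin 2)} {R : ℝ}
    (hAB : A ≠ B) (hBC : B ≠ C) (hCA : C ≠ A)
    (hI : I ∈ convexHull ℝ ({A, B, C} : Set (EuclideanSpace ℝ (Fin 2))))
    (h₁ : infDist I (affineSpan ℝ ({A, B} : Set (EuclideanSpace ℝ (Fin 2))) :
      Set (EuclideanSpace ℝ (Fin 2))) = R)
    (h₂ : infDist I (affineSpan ℝ ({B, C} : Set (EuclideanSpace ℝ (Fin 2))) :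
      Set (EuclideanSpace ℝ (Fin 2))) = R)
    (h₃ : infDist I (affineSpan ℝ ({C, A} : Set (EuclideanSpace ℝ (Fin 2))) :
      Set (EuclideanSpace ℝ (Fin 2))) = R) :
    R * (dist A B + dist B C + dist C A) = |planeCross A B C| := by
  rw [convexHull_insert (by simp), convexHull_pair, convexJoin_singleton_left] at hI
  obtain ⟨D, ⟨v, w, hv, hw, hvw, rfl⟩, a, b, ha, hb, hab, rfl⟩ := by
    simpa only [Set.mem_iUnion, exists_prop] using hI
  have hA : planeCross A B (a • A + b • (v • B + w • C)) = b * w * planeCross A B C := by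
    obtain rfl : a = 1 - b := by linarith
    obtain rfl : v = 1 - w := by linarith
    simp only [planeCross, PiLp.add_apply, PiLp.smul_apply, smul_eq_mul]
    ring
  have hB : planeCross B C (a • A + b • (v • B + w • C)) = a * planeCross A B C := by
    obtain rfl : a = 1 - b := by linarith
    obtain rfl : v = 1 - w := by linarith
    simp only [planeCross, PiLp.add_apply, PiLp.smul_apply, smul_eq_mul]
    ring
  have hC : planeCross C A (a • A + b • (v • B + w • C)) = b * v * planeCross A B C := by
    obtain rfl : a = 1 - b := by linarith
    obtain rfl : v = 1 - w := by linarith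
    simp only [planeCross, PiLp.add_apply, PiLp.smul_apply, smul_eq_mul]
    ring
  have k₁ := infDist_line_mul_dist hAB (a • A + b • (v • B + w • C))
  have k₂ := infDist_line_mul_dist hBC (a • A + b • (v • B + w • C))
  have k₃ := infDist_line_mul_dist hCA (a • A + b • (v • B + w • C))
  rw [h₁, hA, abs_mul, abs_of_nonneg (by positivity)] at k₁
  rw [h₂, hB, abs_mul, abs_of_nonneg ha] at k₂
  rw [h₃, hC, abs_mul, abs_of_nonneg (by positivity)] at k₃
  linear_combination k₁ + k₂ + k₃ + |planeCross A B C| * (b * hvw + hab)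

lemma dist_of_circle {A B O : EuclideanSpace ℝ (Fin 2)} {ρ α β : ℝ} (hρ : 0 < ρ)
    (hA : A 0 = O 0 + ρ * cos α ∧ A 1 = O 1 + ρ * sin α)
    (hB : B 0 = O 0 + ρ * cos β ∧ B 1 = O 1 + ρ * sin β)
    (h : α ≤ β) (h' : β ≤ α + 2 * π) :
    dist A B = 2 * ρ * sin ((β - α) / 2) := by
  have hs : 0 ≤ sin ((β - α) / 2) := sin_nonneg_of_nonneg_of_le_pi (by linarith) (by linarith)
  rw [← sq_eq_sq₀ dist_nonneg (by positivity), dist_sq_eq_coords, hA.1, hA.2, hB.1, hB.2]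
  have e₁ := cos_sub_cos β α
  have e₂ := sin_sub_sin β α
  calc _ = ρ ^ 2 * ((cos β - cos α) ^ 2 + (sin β - sin α) ^ 2) := by ring
    _ = _ := by
      rw [e₁, e₂]
      linear_combination 4 * ρ ^ 2 * sin ((β - α) / 2) ^ 2 * sin_sq_add_cos_sq ((β + α) / 2)

lemma planeCross_of_circle {A B C O : EuclideanSpace ℝ (Fin 2)} {ρ α β γ : ℝ}
    (hA : A 0 = O 0 + ρ * cos α ∧ A 1 = O 1 + ρ * sin α)
    (hB : B 0 = O 0 + ρ * cos β ∧ B 1 = O 1 + ρ * sin β)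
    (hC : C 0 = O 0 + ρ * cos γ ∧ C 1 = O 1 + ρ * sin γ) :
    planeCross A B C =
      4 * ρ ^ 2 * sin ((β - α) / 2) * sin ((γ - α) / 2) * sin ((γ - β) / 2) := by
  have e : sin ((γ - β) / 2) = sin ((γ + α) / 2 - (β + α) / 2) := by ring_nf
  rw [planeCross, hA.1, hA.2, hB.1, hB.2, hC.1, hC.2, e, sin_sub]
  calc _ = ρ ^ 2 * ((cos β - cos α) * (sin γ - sin α) - (sin β - sin α) * (cos γ - cos α)) := by
        ring
    _ = _ := by
      rw [cos_sub_cos, cos_sub_cos, sin_sub_sin, sin_sub_sin]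
      ring

/-- The inradius, semiperimeter and tangent lengths of a triangle inscribed in a circle of
radius `ρ`, in terms of its half angles `x`, `y` and `π / 2 - (x + y)`. -/
lemma inscribed_triangle_formulas {a b c p s r t R ρ x y : ℝ} (hρ : 0 < ρ)
    (hx : 0 < x) (hy : 0 < y) (hxy : x + y < π / 2)
    (ha : a = 2 * ρ * sin (2 * x)) (hb : b = 2 * ρ * sin (2 * y))
    (hc : c = 2 * ρ * sin (2 * (x + y)))
    (hp : p = (a + b + c) / 2) (hs : s = p - b) (hr : r = p - c) (ht : t = p - a)
    (hR : R * (a + b + c) = 4 * ρ ^ 2 * sin (2 * x) * sin (2 * (x + y)) * sin (2 * y)) :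
    p / s = tan (x + y) / tan x ∧ r = R * tan (x + y) ∧ t = R / tan x := by
  have sx : 0 < sin x := sin_pos_of_pos_of_lt_pi hx (by linarith)
  have sy : 0 < sin y := sin_pos_of_pos_of_lt_pi hy (by linarith)
  have sz : 0 < sin (x + y) := sin_pos_of_pos_of_lt_pi (by linarith) (by linarith)
  have cx : 0 < cos x := cos_pos_of_mem_Ioo ⟨by linarith, by linarith⟩
  have cy : 0 < cos y := cos_pos_of_mem_Ioo ⟨by linarith, by linarith⟩
  have cz : 0 < cos (x + y) := cos_pos_of_mem_Ioo ⟨by linarith, by linarith⟩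
  have e₁ : sin (2 * x) + sin (2 * y) = 2 * sin (x + y) * cos (x - y) := by
    rw [sin_add_sin]; ring_nf
  have e₂ : sin (2 * x) - sin (2 * y) = 2 * sin (x - y) * cos (x + y) := by
    rw [sin_sub_sin]; ring_nf
  have e₃ := sin_two_mul (x + y)
  have hp' : p = 4 * ρ * cos x * cos y * sin (x + y) := by
    have : cos (x - y) + cos (x + y) = 2 * cos x * cos y := by rw [cos_sub, cos_add]; ring
    rw [hp, ha, hb, hc]
    linear_combination ρ * e₁ + ρ * e₃ + 2 * ρ * sin (x + y) * this
  have hr' : r = 4 * ρ * sin x * sin y * sin (x + y) := by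
    have : cos (x - y) - cos (x + y) = 2 * sin x * sin y := by rw [cos_sub, cos_add]; ring
    rw [hr, hp, ha, hb, hc]
    linear_combination ρ * e₁ - ρ * e₃ + 2 * ρ * sin (x + y) * this
  have hs' : s = 4 * ρ * sin x * cos y * cos (x + y) := by
    have : sin (x + y) + sin (x - y) = 2 * sin x * cos y := by rw [sin_sub, sin_add]; ring
    rw [hs, hp, ha, hb, hc]
    linear_combination ρ * e₂ + ρ * e₃ + 2 * ρ * cos (x + y) * this
  have ht' : t = 4 * ρ * cos x * sin y * cos (x + y) := by
    have : sin (x + y) - sin (x - y) = 2 * cos x * sin y := by rw [sin_sub, sin_add]; ring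
    rw [ht, hp, ha, hb, hc]
    linear_combination -ρ * e₂ + ρ * e₃ + 2 * ρ * cos (x + y) * this
  have hR' : R = 4 * ρ * sin x * sin y * cos (x + y) := by
    have hpos : 0 < 2 * p := by rw [hp']; positivity
    have habc : a + b + c = 2 * p := by rw [hp]; ring
    rw [habc] at hR
    apply mul_right_cancel₀ hpos.ne'
    rw [hR, hp', sin_two_mul, sin_two_mul, sin_two_mul]
    ring
  rw [tan_eq_sin_div_cos, tan_eq_sin_div_cos, hp', hs', hr', ht', hR']
  refine ⟨?_, ?_, ?_⟩ <;> field_simp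

/-- For the fan triangulation of a convex cyclic polygon, the product of the
inradii of two of the triangles is given by
`R_h · R_k = r_h · t_k · ∏_{i=h+1}^{k-1} (p_i / s_i)`. -/
theorem cyclic_polygon_inradius_product
    (n : ℕ) (hn : 1 ≤ n)
    (Q : ℕ → EuclideanSpace ℝ (Fin 2))
    (O : EuclideanSpace ℝ (Fin 2)) (ρ : ℝ) (θ : ℕ → ℝ)
    (hρ : 0 < ρ)
    (hθmem : ∀ i ≤ n + 1, θ i ∈ Set.Ico 0 (2 * π))
    (hθmono : StrictMonoOn θ (Set.Iic (n + 1)))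
    (hQ : ∀ i ≤ n + 1,
      Q i 0 = O 0 + ρ * Real.cos (θ i) ∧ Q i 1 = O 1 + ρ * Real.sin (θ i))
    (hinj : ∀ i ≤ n + 1, ∀ j ≤ n + 1, Q i = Q j → i = j)
    (p s r t : ℕ → ℝ)
    (hp : ∀ j, 1 ≤ j → j ≤ n →
      p j = (dist (Q 0) (Q j) + dist (Q j) (Q (j + 1)) + dist (Q (j + 1)) (Q 0)) / 2)
    (hs : ∀ j, 1 ≤ j → j ≤ n → s j = p j - dist (Q j) (Q (j + 1)))
    (hr : ∀ j, 1 ≤ j → j ≤ n → r j = p j - dist (Q 0) (Q (j + 1)))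
    (ht : ∀ j, 1 ≤ j → j ≤ n → t j = p j - dist (Q 0) (Q j))
    (R : ℕ → ℝ)
    (hRpos : ∀ j, 1 ≤ j → j ≤ n → 0 < R j)
    (hR : ∀ j, 1 ≤ j → j ≤ n →
      ∃ I ∈ interior (convexHull ℝ
          ({Q 0, Q j, Q (j + 1)} : Set (EuclideanSpace ℝ (Fin 2)))),
        infDist I (affineSpan ℝ ({Q 0, Q j} : Set (EuclideanSpace ℝ (Fin 2))) :
          Set (EuclideanSpace ℝ (Fin 2))) = R j ∧
        infDist I (affineSpan ℝ ({Q j, Q (j + 1)} : Set (EuclideanSpace ℝ (Fin 2))) :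
          Set (EuclideanSpace ℝ (Fin 2))) = R j ∧
        infDist I (affineSpan ℝ ({Q (j + 1), Q 0} : Set (EuclideanSpace ℝ (Fin 2))) :
          Set (EuclideanSpace ℝ (Fin 2))) = R j) :
    ∀ h k, 1 ≤ h → h < k → k ≤ n →
      R h * R k = r h * t k * ∏ i ∈ Finset.Icc (h + 1) (k - 1), p i / s i := by
  have hθlt : ∀ i j, i < j → j ≤ n + 1 → θ i < θ j := fun i j hij hj =>
    hθmono (Set.mem_Iic.2 (by omega)) (Set.mem_Iic.2 hj) hij
  have hdist : ∀ i j, i ≤ j → j ≤ n + 1 →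
      dist (Q i) (Q j) = 2 * ρ * sin ((θ j - θ i) / 2) := fun i j hij hj => by
    have h₁ := (hθmem j hj).2
    have h₂ := (hθmem i (by omega)).1
    exact dist_of_circle hρ (hQ i (by omega)) (hQ j hj)
      (hθmono.monotoneOn (Set.mem_Iic.2 (by omega)) (Set.mem_Iic.2 hj) hij) (by linarith)
  have hne : ∀ i j, i ≤ n + 1 → j ≤ n + 1 → i ≠ j → Q i ≠ Q j := fun i j hi hj hij h =>
    hij (hinj i hi j hj h)
  set τ : ℕ → ℝ := fun j => tan ((θ j - θ 0) / 4) with hτ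
  have hτpos : ∀ j, 1 ≤ j → j ≤ n + 1 → 0 < τ j := fun j hj hjn => by
    have h₀ := hθlt 0 j (by omega) hjn
    have h₁ := (hθmem j hjn).2
    have h₂ := (hθmem 0 (by omega)).1
    exact tan_pos_of_pos_of_lt_pi_div_two (by linarith) (by linarith)
  have formulas : ∀ j, 1 ≤ j → j ≤ n →
      p j / s j = τ (j + 1) / τ j ∧ r j = R j * τ (j + 1) ∧ t j = R j / τ j := by
    intro j hj hjn
    have h₀ := hθlt 0 j (by omega) (by omega)
    have h₁ := hθlt j (j + 1) (by omega) (by omega)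
    have h₂ := (hθmem (j + 1) (by omega)).2
    have h₃ := (hθmem 0 (by omega)).1
    obtain ⟨I, hI, d₁, d₂, d₃⟩ := hR j hj hjn
    have area := inradius_mul_perimeter (hne 0 j (by omega) (by omega) (by omega))
      (hne j (j + 1) (by omega) (by omega) (by omega))
      (hne (j + 1) 0 (by omega) (by omega) (by omega)) (interior_subset hI) d₁ d₂ d₃
    rw [planeCross_of_circle (hQ 0 (by omega)) (hQ j (by omega)) (hQ (j + 1) (by omega))] at area
    have hpos₁ : 0 < sin ((θ j - θ 0) / 2) :=
      sin_pos_of_pos_of_lt_pi (by linarith) (by linarith)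
    have hpos₂ : 0 < sin ((θ (j + 1) - θ 0) / 2) :=
      sin_pos_of_pos_of_lt_pi (by linarith) (by linarith)
    have hpos₃ : 0 < sin ((θ (j + 1) - θ j) / 2) :=
      sin_pos_of_pos_of_lt_pi (by linarith) (by linarith)
    rw [abs_of_pos (by positivity), dist_comm (Q (j + 1))] at area
    have hp' := hp j hj hjn
    rw [dist_comm (Q (j + 1))] at hp'
    have ex : (θ j - θ 0) / 2 = 2 * ((θ j - θ 0) / 4) := by ring
    have ey : (θ (j + 1) - θ j) / 2 = 2 * ((θ (j + 1) - θ j) / 4) := by ring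
    have ez : (θ (j + 1) - θ 0) / 2 =
        2 * ((θ j - θ 0) / 4 + (θ (j + 1) - θ j) / 4) := by ring
    have exy : (θ (j + 1) - θ 0) / 4 = (θ j - θ 0) / 4 + (θ (j + 1) - θ j) / 4 := by ring
    have := inscribed_triangle_formulas (x := (θ j - θ 0) / 4) (y := (θ (j + 1) - θ j) / 4) hρ
      (by linarith) (by linarith) (by linarith)
      (by rw [hdist 0 j (by omega) (by omega), ex])
      (by rw [hdist j (j + 1) (by omega) (by omega), ey])
      (by rw [hdist 0 (j + 1) (by omega) (by omega), ez])
      hp' (hs j hj hjn) (hr j hj hjn) (ht j hj hjn)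
      (by rw [← ex, ← ey, ← ez]; exact area)
    simpa only [hτ, exy] using this
  have hprod : ∀ h k, 1 ≤ h → h < k → k ≤ n →
      ∏ i ∈ Finset.Icc (h + 1) (k - 1), p i / s i = τ k / τ (h + 1) := by
    intro h k hh hhk hkn
    have hIcc : Finset.Icc (h + 1) (k - 1) = Finset.Ico (h + 1) k := by
      ext i; simp only [Finset.mem_Icc, Finset.mem_Ico]; omega
    rw [hIcc, Finset.prod_congr rfl fun i hi => (formulas i
      (by have := Finset.mem_Ico.1 hi; omega) (by have := Finset.mem_Ico.1 hi; omega)).1]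
    induction k, hhk using Nat.le_induction with
    | base => simp [(hτpos (h + 1) (by omega) (by omega)).ne']
    | succ k hk ih =>
      have hk0 := (hτpos k (by omega) (by omega)).ne'
      rw [Finset.prod_Ico_succ_top hk, ih (by omega) (by
        ext i; simp only [Finset.mem_Icc, Finset.mem_Ico]; omega)]
      field_simp
  intro h k hh hhk hkn
  have hh0 := (hτpos (h + 1) (by omega) (by omega)).ne'
  have hk0 := (hτpos k (by omega) (by omega)).ne'
  rw [hprod h k hh hhk hkn, (formulas h hh (by omega)).2.1, (formulas k (by omega) hkn).2.2]
  field_simp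
end
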